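/- arXiv:1805.05529 — 2 statements merged into one kernel-verified Lean document; each statement's English description precedes it below -/
import Mathlib

section
/- Let β ∈ {1,2,4}, let N₀, N be integers with 1 ≤ N₀ < N, and let 0 < b₂ ≤ b₁. Define p(t) = (b₁^{βN₀/2} b₂^{β(N−N₀)/2} / Γ(βN/2)) t^{βN/2−1} e^{−b₂ t} ₁F₁(βN₀/2; βN/2; (b₂−b₁)t) for t > 0. Then for every real s with s > −βN/2, ∫₀^∞ t^s p(t) dt = (Γ(βN/2 + s)/Γ(βN/2)) b₂^{−s} ₂F₁(βN₀/2, −s; βN/2; 1 − b₂/b₁). -/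
open MeasureTheory Real

/-- The ascending factorial (Pochhammer symbol) `(c)_n = c(c+1)⋯(c+n-1)`. -/
noncomputable def risingFactorial (c : ℝ) (n : ℕ) : ℝ :=
  ∏ i ∈ Finset.range n, (c + i)

/-- The confluent hypergeometric function `₁F₁(a;b;z) = Σ_n ((a)_n/(b)_n) zⁿ/n!`. -/
noncomputable def hyp1F1 (a b z : ℝ) : ℝ :=
  ∑' n : ℕ, (risingFactorial a n / risingFactorial b n) * z ^ n / (n.factorial : ℝ)

/-- The Gauss hypergeometric function `₂F₁(a,b;c;z) = Σ_n ((a)_n(b)_n/(c)_n) zⁿ/n!`. -/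
noncomputable def hyp2F1 (a b c z : ℝ) : ℝ :=
  ∑' n : ℕ, (risingFactorial a n * risingFactorial b n / risingFactorial c n) *
    z ^ n / (n.factorial : ℝ)

theorem risingFactorial_zero (c : ℝ) : risingFactorial c 0 = 1 := by
  simp [risingFactorial]

theorem risingFactorial_succ (c : ℝ) (n : ℕ) :
    risingFactorial c (n + 1) = risingFactorial c n * (c + n) :=
  Finset.prod_range_succ _ _

theorem risingFactorial_pos {c : ℝ} (hc : 0 < c) (n : ℕ) : 0 < risingFactorial c n :=
  Finset.prod_pos fun _ _ => by positivity

theorem risingFactorial_eq_ascPochhammer_eval (c : ℝ) (n : ℕ) :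
    risingFactorial c n = (ascPochhammer ℝ n).eval c := by
  induction n with
  | zero => simp [risingFactorial_zero]
  | succ n ih => rw [risingFactorial_succ, ascPochhammer_succ_eval, ih]

theorem Gamma_add_natCast {x : ℝ} (hx : 0 < x) (n : ℕ) :
    Gamma (x + n) = risingFactorial x n * Gamma x := by
  induction n with
  | zero => simp [risingFactorial_zero]
  | succ n ih =>
    have hne : x + n ≠ 0 := by positivity
    rw [risingFactorial_succ, Nat.cast_succ, ← add_assoc, Gamma_add_one hne, ih]
    ring

/-- The Cauchy product of two hypergeometric sequences is again hypergeometric, provided their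
term ratios satisfy a compatibility condition. This covers both the Chu–Vandermonde and the
Pfaff–Saalschütz summations. -/
theorem cauchyProduct_hypergeometric_recurrence {f g p q P : ℕ → ℝ} {c : ℝ}
    (hf : ∀ k : ℕ, (k + 1) * (c + k) * f (k + 1) = p k * f k)
    (hg : ∀ j : ℕ, (j + 1) * g (j + 1) = q j * g j)
    (hP : ∀ k j : ℕ, (c + 2 * k + j) * q j = P (k + j) - p k) (n : ℕ) :
    (n + 1) * (c + n) * ∑ k ∈ Finset.range (n + 2), f k * g (n + 1 - k) =
      P n * ∑ k ∈ Finset.range (n + 1), f k * g (n - k) := by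
  have telescope := Finset.sum_range_sub
    (fun k : ℕ => -(k * (c + k - 1) * f k * g (n + 1 - k))) (n + 1)
  have summand : ∀ k ∈ Finset.range (n + 1),
      -(((k + 1 : ℕ) : ℝ) * (c + (k + 1 : ℕ) - 1) * f (k + 1) * g (n + 1 - (k + 1))) -
          -(k * (c + k - 1) * f k * g (n + 1 - k)) =
        (n + 1) * (c + n) * (f k * g (n + 1 - k)) - P n * (f k * g (n - k)) := by
    intro k hk
    obtain ⟨j, rfl⟩ := Nat.exists_eq_add_of_le (Nat.lt_succ_iff.mp (Finset.mem_range.mp hk))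
    have e₁ : k + j + 1 - k = j + 1 := by omega
    have e₂ : k + j + 1 - (k + 1) = j := by omega
    have e₃ : k + j - k = j := by omega
    rw [e₁, e₂, e₃]
    push_cast
    linear_combination -g j * hf k - f k * (c + 2 * k + j) * hg j - f k * g j * hP k j
  rw [Finset.sum_congr rfl summand, Finset.sum_sub_distrib, ← Finset.mul_sum,
    ← Finset.mul_sum] at telescope
  rw [Finset.sum_range_succ]
  simp only [Nat.sub_self, Nat.cast_zero] at telescope ⊢
  push_cast at telescope
  linear_combination telescope

/-- The Chu–Vandermonde summation, in the form behind Kummer's transformation. -/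
theorem sum_range_chuVandermonde (a : ℝ) {c : ℝ} (hc : 0 < c) (n : ℕ) :
    ∑ k ∈ Finset.range (n + 1),
        risingFactorial a k / risingFactorial c k * (-1) ^ k / (k.factorial : ℝ) *
          (1 / ((n - k).factorial : ℝ)) =
      risingFactorial (c - a) n / risingFactorial c n / (n.factorial : ℝ) := by
  induction n with
  | zero => simp [risingFactorial_zero]
  | succ n ih =>
    have key := cauchyProduct_hypergeometric_recurrence (c := c)
      (f := fun k => risingFactorial a k / risingFactorial c k * (-1) ^ k / (k.factorial : ℝ))
      (g := fun j => 1 / (j.factorial : ℝ)) (p := fun k => -(a + k)) (q := fun _ => 1)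
      (P := fun n => c - a + n)
      (fun k => by
        have h₁ := (risingFactorial_pos hc k).ne'
        have h₂ : c + k ≠ 0 := by positivity
        simp only [risingFactorial_succ, Nat.factorial_succ]
        push_cast
        field_simp
        ring)
      (fun j => by
        simp only [Nat.factorial_succ]
        push_cast
        field_simp)
      (fun k j => by push_cast; ring) n
    simp only [ih] at key
    have h₁ := (risingFactorial_pos hc n).ne'
    have h₂ : c + n ≠ 0 := by positivity
    have h₃ : (n + 1 : ℝ) * (c + n) ≠ 0 := by positivity
    refine mul_left_cancel₀ h₃ (key.trans ?_)
    simp only [risingFactorial_succ, Nat.factorial_succ]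
    push_cast
    field_simp

/-- The Pfaff–Saalschütz summation, in the form behind Euler's transformation. -/
theorem sum_range_pfaffSaalschutz (a b : ℝ) {c : ℝ} (hc : 0 < c) (n : ℕ) :
    ∑ k ∈ Finset.range (n + 1),
        risingFactorial a k * risingFactorial b k / risingFactorial c k / (k.factorial : ℝ) *
          (risingFactorial (c - a - b) (n - k) / ((n - k).factorial : ℝ)) =
      risingFactorial (c - a) n * risingFactorial (c - b) n / risingFactorial c n /
        (n.factorial : ℝ) := by
  induction n with
  | zero => simp [risingFactorial_zero]
  | succ n ih =>
    have key := cauchyProduct_hypergeometric_recurrence (c := c)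
      (f := fun k => risingFactorial a k * risingFactorial b k / risingFactorial c k /
        (k.factorial : ℝ))
      (g := fun j => risingFactorial (c - a - b) j / (j.factorial : ℝ))
      (p := fun k => (a + k) * (b + k)) (q := fun j => c - a - b + j)
      (P := fun n => (c - a + n) * (c - b + n))
      (fun k => by
        have h₁ := (risingFactorial_pos hc k).ne'
        have h₂ : c + k ≠ 0 := by positivity
        simp only [risingFactorial_succ, Nat.factorial_succ]
        push_cast
        field_simp)
      (fun j => by
        simp only [risingFactorial_succ, Nat.factorial_succ]
        push_cast
        field_simp)
      (fun k j => by push_cast; ring) n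
    simp only [ih] at key
    have h₁ := (risingFactorial_pos hc n).ne'
    have h₂ : c + n ≠ 0 := by positivity
    have h₃ : (n + 1 : ℝ) * (c + n) ≠ 0 := by positivity
    refine mul_left_cancel₀ h₃ (key.trans ?_)
    simp only [risingFactorial_succ, Nat.factorial_succ]
    push_cast
    field_simp

/-- A ratio test for sequences some of whose terms may vanish. -/
theorem summable_of_tendsto_ratio {f r : ℕ → ℝ} {l : ℝ} (hl : |l| < 1)
    (hf : ∀ n, f (n + 1) = r n * f n) (hr : Filter.Tendsto r Filter.atTop (nhds l)) :
    Summable f := by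
  obtain ⟨ρ, hlρ, hρ⟩ := exists_between hl
  refine summable_of_ratio_norm_eventually_le hρ ?_
  filter_upwards [hr.abs.eventually (gt_mem_nhds hlρ)] with n hn
  rw [hf, norm_mul]
  exact mul_le_mul_of_nonneg_right hn.le (norm_nonneg _)

theorem tendsto_add_natCast_div_add_natCast (a b : ℝ) :
    Filter.Tendsto (fun n : ℕ => (a + n) / (b + n)) Filter.atTop (nhds 1) := by
  simpa using tendsto_add_mul_div_add_mul_atTop_nhds a b 1 one_ne_zero

theorem summable_hyp1F1 (a : ℝ) {c : ℝ} (hc : 0 < c) (z : ℝ) :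
    Summable fun n : ℕ =>
      risingFactorial a n / risingFactorial c n * z ^ n / (n.factorial : ℝ) := by
  refine summable_of_tendsto_ratio (l := 0)
    (r := fun n : ℕ => (a + n) / (c + n) * (z * (1 / ((n : ℝ) + 1)))) (by simp) (fun n => ?_) ?_
  · have h₁ := (risingFactorial_pos hc n).ne'
    have h₂ : c + n ≠ 0 := by positivity
    simp only [risingFactorial_succ, Nat.factorial_succ]
    push_cast
    field_simp
    ring
  · simpa using (tendsto_add_natCast_div_add_natCast a c).mul
      (tendsto_one_div_add_atTop_nhds_zero_nat.const_mul z)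

theorem summable_hyp2F1 (a b : ℝ) {c z : ℝ} (hc : 0 < c) (hz : |z| < 1) :
    Summable fun n : ℕ => risingFactorial a n * risingFactorial b n / risingFactorial c n *
      z ^ n / (n.factorial : ℝ) := by
  refine summable_of_tendsto_ratio (l := z)
    (r := fun n : ℕ => (a + n) / (c + n) * ((b + n) / (1 + n)) * z) hz (fun n => ?_) ?_
  · have h₁ := (risingFactorial_pos hc n).ne'
    have h₂ : c + n ≠ 0 := by positivity
    simp only [risingFactorial_succ, Nat.factorial_succ]
    push_cast
    field_simp
    ring
  · simpa using ((tendsto_add_natCast_div_add_natCast a c).mul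
      (tendsto_add_natCast_div_add_natCast b 1)).mul_const z

/-- The binomial series. -/
theorem hasSum_risingFactorial_div_factorial_mul_pow (e : ℝ) {z : ℝ} (hz : |z| < 1) :
    HasSum (fun n : ℕ => risingFactorial e n / (n.factorial : ℝ) * z ^ n) ((1 - z) ^ (-e)) := by
  have h := (one_div_one_sub_rpow_hasFPowerSeriesOnBall_zero e).hasSum (y := z)
    (by simpa [enorm_eq_nnnorm, ← NNReal.coe_lt_coe] using hz)
  have hcoeff : ∀ n : ℕ, Ring.choose (e + n - 1) n = risingFactorial e n / (n.factorial : ℝ) := by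
    intro n
    have := Ring.factorial_nsmul_multichoose_eq_ascPochhammer e n
    rw [Polynomial.ascPochhammer_smeval_eq_eval, ← risingFactorial_eq_ascPochhammer_eval,
      nsmul_eq_mul] at this
    rw [Ring.choose, show e + n - 1 - n + 1 = e by ring, ← this]
    field_simp
  simpa [FormalMultilinearSeries.ofScalars_apply_eq, hcoeff, zero_add, mul_comm,
    rpow_neg (show (0 : ℝ) ≤ 1 - z by linarith [(abs_lt.mp hz).2])] using h

/-- Kummer's transformation. -/
theorem hyp1F1_neg_mul_exp (a : ℝ) {c : ℝ} (hc : 0 < c) (x : ℝ) :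
    hyp1F1 a c (-x) * exp x = hyp1F1 (c - a) c x := by
  have hexp : HasSum (fun n : ℕ => x ^ n / (n.factorial : ℝ)) (exp x) := by
    rw [Real.exp_eq_exp_ℝ]
    exact NormedSpace.expSeries_div_hasSum_exp x
  rw [hyp1F1, hyp1F1, ← hexp.tsum_eq, tsum_mul_tsum_eq_tsum_sum_range_of_summable_norm
    (summable_hyp1F1 a hc (-x)).norm hexp.summable.norm]
  refine tsum_congr fun n => ?_
  rw [mul_div_right_comm, ← sum_range_chuVandermonde a hc n, Finset.sum_mul]
  refine Finset.sum_congr rfl fun k hk => ?_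
  rw [neg_pow x k, ← pow_mul_pow_sub x (Nat.lt_succ_iff.mp (Finset.mem_range.mp hk))]
  ring

/-- Euler's transformation. -/
theorem hyp2F1_mul_one_sub_rpow (a b : ℝ) {c z : ℝ} (hc : 0 < c) (hz : |z| < 1) :
    hyp2F1 a b c z * (1 - z) ^ (-(c - a - b)) = hyp2F1 (c - a) (c - b) c z := by
  have hbin := hasSum_risingFactorial_div_factorial_mul_pow (c - a - b) hz
  rw [hyp2F1, hyp2F1, ← hbin.tsum_eq, tsum_mul_tsum_eq_tsum_sum_range_of_summable_norm
    (summable_hyp2F1 a b hc hz).norm hbin.summable.norm]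
  refine tsum_congr fun n => ?_
  rw [mul_div_right_comm, ← sum_range_pfaffSaalschutz a b hc n, Finset.sum_mul]
  refine Finset.sum_congr rfl fun k hk => ?_
  rw [← pow_mul_pow_sub z (Nat.lt_succ_iff.mp (Finset.mem_range.mp hk))]
  ring

/-- The Mellin–Laplace transform of `₁F₁`. -/
theorem integral_rpow_mul_exp_mul_hyp1F1 (a : ℝ) {c u r x : ℝ} (hc : 0 < c) (hu : 0 < u)
    (hr : 0 < r) (hx : |x / r| < 1) :
    ∫ t in Set.Ioi (0 : ℝ), t ^ (u - 1) * exp (-(r * t)) * hyp1F1 a c (x * t) =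
      Gamma u * r ^ (-u) * hyp2F1 a u c (x / r) := by
  set w : ℕ → ℝ := fun n =>
    risingFactorial a n / risingFactorial c n * x ^ n / (n.factorial : ℝ)
  set F : ℕ → ℝ → ℝ := fun n t => w n * (t ^ (u + n - 1) * exp (-(r * t)))
  have hI : ∀ n : ℕ, ∫ t in Set.Ioi (0 : ℝ), t ^ (u + n - 1) * exp (-(r * t)) =
      (1 / r) ^ (u + n) * Gamma (u + n) :=
    fun n => integral_rpow_mul_exp_neg_mul_Ioi (by positivity) hr
  have hint : ∀ n, Integrable (F n) (volume.restrict (Set.Ioi 0)) := fun n => by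
    refine Integrable.const_mul (.of_integral_ne_zero ?_) _
    have := Gamma_pos_of_pos (show 0 < u + n by positivity)
    rw [hI]
    positivity
  have hval : ∀ n : ℕ, (1 / r) ^ (u + n) * Gamma (u + n) =
      Gamma u * r ^ (-u) * (risingFactorial u n / r ^ n) := by
    intro n
    rw [Gamma_add_natCast hu, one_div, rpow_add (by positivity), rpow_natCast,
      inv_rpow hr.le, rpow_neg hr.le, inv_pow]
    ring
  have hterm : ∀ n : ℕ, w n * ((1 / r) ^ (u + n) * Gamma (u + n)) = Gamma u * r ^ (-u) *
      (risingFactorial a n * risingFactorial u n / risingFactorial c n * (x / r) ^ n /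
        (n.factorial : ℝ)) := by
    intro n
    rw [hval, div_pow]
    ring
  have hnorm : Summable fun n => ∫ t in Set.Ioi (0 : ℝ), ‖F n t‖ := by
    refine ((summable_hyp2F1 a u hc hx).mul_left (Gamma u * r ^ (-u))).norm.congr fun n => ?_
    have hpos : 0 ≤ (1 / r) ^ (u + n) * Gamma (u + n) := by
      have := Gamma_pos_of_pos (show 0 < u + n by positivity)
      positivity
    rw [← hterm, norm_mul, Real.norm_of_nonneg hpos, ← hI, ← integral_const_mul]
    refine setIntegral_congr_fun measurableSet_Ioi fun t (ht : 0 < t) => ?_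
    have : 0 ≤ t ^ (u + n - 1) * exp (-(r * t)) := by positivity
    simp only [F, norm_mul (w n), Real.norm_of_nonneg this]
  have hsum := integral_tsum_of_summable_integral_norm hint hnorm
  rw [hyp2F1, ← tsum_mul_left, ← tsum_congr hterm]
  simp only [F, integral_const_mul, hI] at hsum
  rw [hsum]
  refine setIntegral_congr_fun measurableSet_Ioi fun t (ht : 0 < t) => ?_
  simp only [hyp1F1, ← tsum_mul_left]
  refine tsum_congr fun n => ?_
  rw [show u + n - 1 = u - 1 + n by ring, rpow_add ht, rpow_natCast, mul_pow]
  ring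

theorem statement13 (β N₀ N : ℕ) (hβ : β = 1 ∨ β = 2 ∨ β = 4)
    (hN₀ : 1 ≤ N₀) (hN : N₀ < N) (b₁ b₂ : ℝ) (hb₂ : 0 < b₂) (hb : b₂ ≤ b₁)
    (s : ℝ) (hs : -((β : ℝ) * N / 2) < s) :
    ∫ t in Set.Ioi (0 : ℝ),
        t ^ s * (b₁ ^ ((β : ℝ) * N₀ / 2) * b₂ ^ ((β : ℝ) * ((N : ℝ) - N₀) / 2) /
            Real.Gamma ((β : ℝ) * N / 2) *
          t ^ ((β : ℝ) * N / 2 - 1) * Real.exp (-b₂ * t) *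
          hyp1F1 ((β : ℝ) * N₀ / 2) ((β : ℝ) * N / 2) ((b₂ - b₁) * t)) =
      (Real.Gamma ((β : ℝ) * N / 2 + s) / Real.Gamma ((β : ℝ) * N / 2)) * b₂ ^ (-s) *
        hyp2F1 ((β : ℝ) * N₀ / 2) (-s) ((β : ℝ) * N / 2) (1 - b₂ / b₁) := by
  have hβ₀ : 0 < β := by omega
  set a : ℝ := (β : ℝ) * N₀ / 2 with ha
  set c : ℝ := (β : ℝ) * N / 2 with hcdef
  have hc : 0 < c := by
    have : 0 < N := by omega
    positivity
  have hca : (β : ℝ) * ((N : ℝ) - N₀) / 2 = c - a := by rw [ha, hcdef]; ring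
  have hb₁ : 0 < b₁ := hb₂.trans_le hb
  have hz : |(b₁ - b₂) / b₁| < 1 := by
    rw [abs_of_nonneg (div_nonneg (sub_nonneg.mpr hb) hb₁.le), div_lt_one hb₁]
    linarith
  have hz' : 1 - b₂ / b₁ = (b₁ - b₂) / b₁ := by field_simp
  have hintegrand : ∀ t ∈ Set.Ioi (0 : ℝ),
      t ^ s * (b₁ ^ a * b₂ ^ (c - a) / Gamma c * t ^ (c - 1) * exp (-b₂ * t) *
        hyp1F1 a c ((b₂ - b₁) * t)) =
      b₁ ^ a * b₂ ^ (c - a) / Gamma c * (t ^ (c + s - 1) * exp (-(b₁ * t)) *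
        hyp1F1 (c - a) c ((b₁ - b₂) * t)) := by
    intro t (ht : 0 < t)
    rw [← hyp1F1_neg_mul_exp a hc, show c + s - 1 = s + (c - 1) by ring, rpow_add ht,
      show -b₂ * t = -(b₁ * t) + (b₁ - b₂) * t by ring, exp_add,
      show (b₂ - b₁) * t = -((b₁ - b₂) * t) by ring]
    ring
  rw [hca, setIntegral_congr_fun measurableSet_Ioi hintegrand, integral_const_mul,
    integral_rpow_mul_exp_mul_hyp1F1 (c - a) hc (by linarith) hb₁ hz, hz']
  have euler := hyp2F1_mul_one_sub_rpow a (-s) hc hz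
  rw [sub_neg_eq_add, sub_neg_eq_add, ← hz', sub_sub_cancel, hz'] at euler
  rw [← euler, div_rpow hb₂.le hb₁.le]
  have hpow : b₁ ^ a * b₂ ^ (c - a) * b₁ ^ (-(c + s)) *
      (b₂ ^ (-(c - a + s)) / b₁ ^ (-(c - a + s))) = b₂ ^ (-s) := by
    rw [div_eq_mul_inv, ← rpow_neg hb₁.le]
    calc _ = (b₁ ^ a * b₁ ^ (-(c + s)) * b₁ ^ (- -(c - a + s))) *
          (b₂ ^ (c - a) * b₂ ^ (-(c - a + s))) := by ring
      _ = b₂ ^ (-s) := by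
        rw [← rpow_add hb₁, ← rpow_add hb₁, ← rpow_add hb₂,
          show a + -(c + s) + - -(c - a + s) = 0 by ring, rpow_zero, one_mul]
        congr 1
        ring
  rw [← hpow]
  ring
end

section
/- Let β and N be positive integers and let α_1, …, α_N > 0 (in the matrix setting α_l = β(N + ν_l − 1)/2 with ν_l > 0). Let y_1, …, y_N be independent random vectors in ℝ^β, where y_l has density (Γ(α_l + β/2)/(π^{β/2} Γ(α_l))) (1 − |y|²)^{α_l−1} supported on the open unit ball of ℝ^β. Then E[ log( Σ_{l=1}^N |y_l|² ) ] is finite and equals ∫₀^∞ ( e^{−t} − ∏_{l=1}^N ₁F₁(β/2; β/2 + α_l; −t) ) dt/t. (Twice the largest Lyapunov exponent of a product of i.i.d. random matrices with independent isotropic beta type I rows equals this integral.) -/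
open MeasureTheory Real

/-- The distribution on `ℝ^β` of a vector with density
`(Γ(a+β/2)/(π^{β/2} Γ(a))) (1-|y|²)^{a-1}` supported on the open unit ball. -/
noncomputable def betaIVecMeasure (β : ℕ) (a : ℝ) : Measure (Fin β → ℝ) :=
  volume.withDensity fun y =>
    ENNReal.ofReal (if ∑ s, y s ^ 2 < 1 then
      (Real.Gamma (a + (β : ℝ) / 2) / (π ^ ((β : ℝ) / 2) * Real.Gamma a)) *
        (1 - ∑ s, y s ^ 2) ^ (a - 1)
    else 0)

open ProbabilityTheory Set
open scoped ENNReal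

/-- Polar coordinates for the lower Lebesgue integral of a radial function. -/
lemma lintegral_fun_norm_addHaar {E : Type*} [NormedAddCommGroup E] [NormedSpace ℝ E]
    [MeasurableSpace E] [BorelSpace E] [FiniteDimensional ℝ E] [Nontrivial E]
    (μ : Measure E) [μ.IsAddHaarMeasure] {f : ℝ → ℝ≥0∞} (hf : Measurable f) :
    ∫⁻ x, f ‖x‖ ∂μ = Module.finrank ℝ E * μ (Metric.ball 0 1) *
      ∫⁻ r in Ioi (0 : ℝ), ENNReal.ofReal (r ^ (Module.finrank ℝ E - 1)) * f r := by
  calc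
    ∫⁻ x, f ‖x‖ ∂μ = ∫⁻ x : ({(0)}ᶜ : Set E), f ‖x.1‖ ∂(μ.comap (↑)) := by
      rw [lintegral_subtype_comap (measurableSet_singleton _).compl fun x ↦ f ‖x‖,
        restrict_compl_singleton]
    _ = ∫⁻ x, f x.2 ∂μ.toSphere.prod (.volumeIoiPow (Module.finrank ℝ E - 1)) := by
      simpa using μ.measurePreserving_homeomorphUnitSphereProd.lintegral_comp
        (f := f ∘ Subtype.val ∘ Prod.snd) (by fun_prop)
    _ = μ.toSphere univ *
        ∫⁻ x : Ioi (0 : ℝ), f x ∂.volumeIoiPow (Module.finrank ℝ E - 1) := by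
      rw [lintegral_prod _ (by fun_prop)]
      simp [mul_comm]
    _ = _ := by
      rw [Measure.volumeIoiPow, lintegral_withDensity_eq_lintegral_mul _ (by fun_prop)
        (by fun_prop), μ.toSphere_apply_univ,
        ← lintegral_subtype_comap measurableSet_Ioi
          fun r ↦ ENNReal.ofReal (r ^ (Module.finrank ℝ E - 1)) * f r]
      rfl

/-- Substitution `x = r ^ 2` in the lower Lebesgue integral over the positive half-line. -/
lemma lintegral_Ioi_eq_lintegral_comp_sq (f : ℝ → ℝ≥0∞) :
    ∫⁻ x in Ioi (0 : ℝ), f x = ∫⁻ r in Ioi (0 : ℝ), ENNReal.ofReal (2 * r) * f (r ^ 2) := by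
  have himage : (fun r : ℝ ↦ r ^ 2) '' Ioi 0 = Ioi 0 := by
    ext x
    constructor
    · rintro ⟨r, hr, rfl⟩
      exact pow_pos (mem_Ioi.1 hr) 2
    · intro hx
      exact ⟨√x, Real.sqrt_pos.2 hx, Real.sq_sqrt (le_of_lt hx)⟩
  have hderiv (r : ℝ) (_ : r ∈ Ioi (0 : ℝ)) :
      HasDerivWithinAt (fun r : ℝ ↦ r ^ 2) (2 * r) (Ioi 0) r := by
    simpa using (hasDerivAt_pow 2 r).hasDerivWithinAt
  have hinj : InjOn (fun r : ℝ ↦ r ^ 2) (Ioi 0) := fun x hx y hy h ↦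
    (pow_left_inj₀ (le_of_lt hx) (le_of_lt hy) two_ne_zero).1 h
  conv_lhs => rw [← himage]
  rw [lintegral_image_eq_lintegral_abs_deriv_mul measurableSet_Ioi hderiv hinj]
  refine setLIntegral_congr_fun measurableSet_Ioi fun r (hr : 0 < r) ↦ ?_
  rw [abs_of_pos (by positivity)]

/-- The squared Euclidean norm turns Lebesgue measure on `ℝ^β` into a power density. -/
lemma lintegral_sum_sq {β : ℕ} (hβ : 0 < β) {f : ℝ → ℝ≥0∞} (hf : Measurable f) :
    ∫⁻ y : Fin β → ℝ, f (∑ s, y s ^ 2) =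
      ENNReal.ofReal (π ^ ((β : ℝ) / 2) / Real.Gamma ((β : ℝ) / 2)) *
        ∫⁻ x in Ioi (0 : ℝ), ENNReal.ofReal (x ^ ((β : ℝ) / 2 - 1)) * f x := by
  have : Nonempty (Fin β) := ⟨⟨0, hβ⟩⟩
  have hβ' : (0 : ℝ) < β := by exact_mod_cast hβ
  have hleft : ∫⁻ y : Fin β → ℝ, f (∑ s, y s ^ 2) =
      ∫⁻ y : EuclideanSpace ℝ (Fin β), f (‖y‖ ^ 2) := by
    rw [← (PiLp.volume_preserving_ofLp (Fin β)).lintegral_comp (by fun_prop)]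
    simp [EuclideanSpace.norm_sq_eq]
  rw [hleft, lintegral_fun_norm_addHaar (f := fun r ↦ f (r ^ 2)) volume (by fun_prop),
    lintegral_Ioi_eq_lintegral_comp_sq
      fun x ↦ ENNReal.ofReal (x ^ ((β : ℝ) / 2 - 1)) * f x, EuclideanSpace.volume_ball]
  have hright : ∫⁻ r in Ioi (0 : ℝ), ENNReal.ofReal (2 * r) *
        (ENNReal.ofReal ((r ^ 2) ^ ((β : ℝ) / 2 - 1)) * f (r ^ 2)) =
      ENNReal.ofReal 2 * ∫⁻ r in Ioi (0 : ℝ), ENNReal.ofReal (r ^ (β - 1)) * f (r ^ 2) := by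
    rw [← lintegral_const_mul _ (by fun_prop)]
    refine setLIntegral_congr_fun measurableSet_Ioi fun r (hr : 0 < r) ↦ ?_
    rw [← mul_assoc, ← mul_assoc, ← ENNReal.ofReal_mul (by positivity),
      ← ENNReal.ofReal_mul (by positivity)]
    congr 2
    rw [mul_assoc]
    congr 1
    rw [← Real.rpow_natCast r 2, ← Real.rpow_mul hr.le, ← Real.rpow_natCast r (β - 1),
      Nat.cast_sub hβ]
    conv_lhs => rw [← Real.rpow_one r, ← Real.rpow_mul hr.le, ← Real.rpow_add hr]
    congr 1
    push_cast
    ring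
  rw [hright]
  simp only [finrank_euclideanSpace, Fintype.card_fin, ENNReal.ofReal_one, one_pow, one_mul]
  rw [← mul_assoc (ENNReal.ofReal _) (ENNReal.ofReal 2), ← ENNReal.ofReal_natCast,
    ← ENNReal.ofReal_mul (by positivity), ← ENNReal.ofReal_mul (by positivity)]
  congr 2
  rw [Real.Gamma_add_one (by positivity), Real.sqrt_eq_rpow, ← Real.rpow_natCast,
    ← Real.rpow_mul pi_pos.le]
  have := (Real.Gamma_pos_of_pos (half_pos hβ')).ne'
  field_simp

lemma measurable_betaPDF (b a : ℝ) : Measurable (betaPDF b a) :=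
  (measurable_betaPDFReal b a).ennreal_ofReal

/-- The squared norm of a beta type I vector has a beta distribution. -/
lemma map_sum_sq_betaIVecMeasure {β : ℕ} (hβ : 0 < β) {a : ℝ} (ha : 0 < a) :
    (betaIVecMeasure β a).map (fun y ↦ ∑ s, y s ^ 2) = betaMeasure ((β : ℝ) / 2) a := by
  have hβ' : (0 : ℝ) < (β : ℝ) / 2 := by positivity
  have hGb := Real.Gamma_pos_of_pos hβ'
  have hGa := Real.Gamma_pos_of_pos ha
  have hG := Real.Gamma_pos_of_pos (add_pos ha hβ')
  let d : ℝ → ℝ≥0∞ := fun x ↦ ENNReal.ofReal (if x < 1 then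
      (Real.Gamma (a + (β : ℝ) / 2) / (π ^ ((β : ℝ) / 2) * Real.Gamma a)) *
        (1 - x) ^ (a - 1) else 0)
  have hd : Measurable d :=
    (Measurable.ite measurableSet_Iio (by fun_prop) measurable_const).ennreal_ofReal
  have hq : Measurable fun y : Fin β → ℝ ↦ ∑ s, y s ^ 2 := by fun_prop
  refine Measure.ext_of_lintegral _ fun f hf ↦ ?_
  rw [lintegral_map hf hq, betaMeasure,
    lintegral_withDensity_eq_lintegral_mul _ (measurable_betaPDF _ _) hf,
    show betaIVecMeasure β a = volume.withDensity (fun y ↦ d (∑ s, y s ^ 2)) from rfl,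
    lintegral_withDensity_eq_lintegral_mul _ (by fun_prop) (by fun_prop)]
  change ∫⁻ y : Fin β → ℝ, (d * f) (∑ s, y s ^ 2) = _
  rw [lintegral_sum_sq hβ (hd.mul hf),
    ← lintegral_const_mul' _ _ ENNReal.ofReal_ne_top,
    ← lintegral_indicator measurableSet_Ioi]
  refine lintegral_congr fun x ↦ ?_
  by_cases hx : 0 < x
  · by_cases hx1 : x < 1
    · simp only [indicator, mem_Ioi, hx, if_true, Pi.mul_apply, d, hx1,
        betaPDF_of_pos_lt_one hx hx1]
      rw [← mul_assoc, ← mul_assoc, ← ENNReal.ofReal_mul (by positivity),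
        ← ENNReal.ofReal_mul (by positivity)]
      congr 2
      rw [beta, add_comm a]
      rw [add_comm a] at hG
      field_simp
    · simp [indicator, hx, d, hx1, betaPDF_eq_zero_of_one_le (not_lt.1 hx1)]
  · simp [indicator, hx, betaPDF_eq_zero_of_nonpos (not_lt.1 hx)]

/-- Real moments of the beta distribution. -/
lemma lintegral_rpow_betaMeasure {b a p : ℝ} (hb : 0 < b) (ha : 0 < a) (hp : 0 < b + p) :
    ∫⁻ x, ENNReal.ofReal (x ^ p) ∂betaMeasure b a =
      ENNReal.ofReal (beta (b + p) a / beta b a) := by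
  have hB := beta_pos hb ha
  have hB' := beta_pos hp ha
  have key (x : ℝ) : betaPDF b a x * ENNReal.ofReal (x ^ p) =
      ENNReal.ofReal (beta (b + p) a / beta b a) * betaPDF (b + p) a x := by
    by_cases hx : 0 < x
    · by_cases hx1 : x < 1
      · have : 0 < 1 - x := by linarith
        rw [betaPDF_of_pos_lt_one hx hx1, betaPDF_of_pos_lt_one hx hx1,
          ← ENNReal.ofReal_mul (by positivity), ← ENNReal.ofReal_mul (by positivity)]
        congr 1
        rw [show b + p - 1 = (b - 1) + p by ring, Real.rpow_add hx]
        field_simp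
      · simp [betaPDF_eq_zero_of_one_le (not_lt.1 hx1)]
    · simp [betaPDF_eq_zero_of_nonpos (not_lt.1 hx)]
  rw [betaMeasure, lintegral_withDensity_eq_lintegral_mul _
    (measurable_betaPDF _ _) (by fun_prop)]
  simp only [Pi.mul_apply, key]
  rw [lintegral_const_mul _ (measurable_betaPDF _ _),
    lintegral_betaPDF_eq_one hp ha, mul_one]

/-- The beta distribution is carried by the open unit interval. -/
lemma ae_mem_Ioo_betaMeasure (b a : ℝ) : ∀ᵐ x ∂betaMeasure b a, x ∈ Ioo (0 : ℝ) 1 := by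
  rw [betaMeasure, ae_withDensity_iff (measurable_betaPDF _ _)]
  refine Filter.Eventually.of_forall fun x hx ↦ ⟨?_, ?_⟩
  · by_contra h
    exact hx (betaPDF_eq_zero_of_nonpos (not_lt.1 h))
  · by_contra h
    exact hx (betaPDF_eq_zero_of_one_le (not_lt.1 h))

/-- Real powers are integrable for the beta distribution as long as the moment is finite. -/
lemma integrable_rpow_betaMeasure {b a p : ℝ} (hb : 0 < b) (ha : 0 < a) (hp : 0 < b + p) :
    Integrable (fun x : ℝ ↦ x ^ p) (betaMeasure b a) := by
  refine ⟨by fun_prop, ?_⟩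
  rw [hasFiniteIntegral_iff_ofReal, lintegral_rpow_betaMeasure hb ha hp]
  · exact ENNReal.ofReal_lt_top
  · filter_upwards [ae_mem_Ioo_betaMeasure b a] with x hx using Real.rpow_nonneg hx.1.le p

lemma Gamma_add_natCast_s18 {b : ℝ} (hb : 0 < b) (n : ℕ) :
    Real.Gamma (b + n) = risingFactorial b n * Real.Gamma b := by
  induction n with
  | zero => simp [risingFactorial]
  | succ n ih =>
    rw [Nat.cast_succ, ← add_assoc, Real.Gamma_add_one (by positivity), ih, risingFactorial,
      risingFactorial, Finset.prod_range_succ]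
    ring

lemma risingFactorial_pos_s18 {b : ℝ} (hb : 0 < b) (n : ℕ) : 0 < risingFactorial b n :=
  Finset.prod_pos fun _ _ ↦ by positivity

/-- Integer moments of the beta distribution. -/
lemma integral_pow_betaMeasure {b a : ℝ} (hb : 0 < b) (ha : 0 < a) (n : ℕ) :
    ∫ x, x ^ n ∂betaMeasure b a = risingFactorial b n / risingFactorial (b + a) n := by
  have hbn : 0 < b + n := by positivity
  have hmoment := lintegral_rpow_betaMeasure hb ha hbn
  simp only [Real.rpow_natCast] at hmoment
  rw [integral_eq_lintegral_of_nonneg_ae _ (by fun_prop), hmoment,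
    ENNReal.toReal_ofReal (div_nonneg (beta_pos hbn ha).le (beta_pos hb ha).le)]
  · rw [beta, beta, add_right_comm, Gamma_add_natCast_s18 hb, Gamma_add_natCast_s18 (add_pos hb ha)]
    have := Real.Gamma_pos_of_pos hb
    have := Real.Gamma_pos_of_pos ha
    have := Real.Gamma_pos_of_pos (add_pos hb ha)
    have := risingFactorial_pos_s18 (add_pos hb ha) n
    field_simp
  · filter_upwards [ae_mem_Ioo_betaMeasure b a] with x hx using pow_nonneg hx.1.le n

/-- The Laplace transform of the beta distribution. -/
lemma integral_exp_neg_mul_betaMeasure {b a : ℝ} (hb : 0 < b) (ha : 0 < a) (t : ℝ) :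
    ∫ x, Real.exp (-(t * x)) ∂betaMeasure b a = hyp1F1 b (b + a) (-t) := by
  have := isProbabilityMeasureBeta hb ha
  have hle (n : ℕ) : ∀ᵐ x ∂betaMeasure b a,
      ‖(-t) ^ n / (n.factorial : ℝ) * x ^ n‖ ≤ |t| ^ n / (n.factorial : ℝ) := by
    filter_upwards [ae_mem_Ioo_betaMeasure b a] with x hx
    rw [norm_mul, norm_div, norm_pow, norm_neg, norm_pow, RCLike.norm_natCast,
      Real.norm_eq_abs, Real.norm_eq_abs, abs_of_pos hx.1]
    exact mul_le_of_le_one_right (by positivity) (pow_le_one₀ hx.1.le hx.2.le)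
  have hint (n : ℕ) :
      Integrable (fun x ↦ (-t) ^ n / (n.factorial : ℝ) * x ^ n) (betaMeasure b a) :=
    (integrable_const _).mono' (by fun_prop) (hle n)
  have hsum : Summable fun n : ℕ ↦
      ∫ x, ‖(-t) ^ n / (n.factorial : ℝ) * x ^ n‖ ∂betaMeasure b a := by
    refine .of_nonneg_of_le (fun n ↦ by positivity) (fun n ↦ ?_)
      (Real.summable_pow_div_factorial |t|)
    simpa using integral_mono_ae (hint n).norm (integrable_const _) (hle n)
  have h := integral_tsum_of_summable_integral_norm hint hsum
  have hexp (x : ℝ) :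
      ∑' n : ℕ, (-t) ^ n / (n.factorial : ℝ) * x ^ n = Real.exp (-(t * x)) := by
    rw [Real.exp_eq_exp_ℝ, NormedSpace.exp_eq_tsum_div]
    refine tsum_congr fun n ↦ ?_
    rw [← neg_mul, mul_pow]
    ring
  simp only [hexp] at h
  rw [← h, hyp1F1]
  refine tsum_congr fun n ↦ ?_
  rw [integral_const_mul, integral_pow_betaMeasure hb ha]
  ring

lemma exp_neg_sub_exp_neg_div_le {t c d : ℝ} (ht : 0 < t) :
    (Real.exp (-(c * t)) - Real.exp (-(d * t))) / t ≤ (d - c) * Real.exp (-(c * t)) := by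
  rw [div_le_iff₀ ht]
  have h := Real.add_one_le_exp (-((d - c) * t))
  have he : Real.exp (-(d * t)) = Real.exp (-(c * t)) * Real.exp (-((d - c) * t)) := by
    rw [← Real.exp_add]
    ring_nf
  nlinarith [Real.exp_pos (-(c * t))]

lemma integrableOn_exp_neg_sub_exp_neg_div_of_le {c d : ℝ} (hc : 0 < c) (hcd : c ≤ d) :
    IntegrableOn (fun t ↦ (Real.exp (-(c * t)) - Real.exp (-(d * t))) / t) (Ioi 0) := by
  have hint : IntegrableOn (fun t ↦ (d - c) * Real.exp (-(c * t))) (Ioi 0) := by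
    simpa [neg_mul, IntegrableOn] using (integrableOn_exp_mul_Ioi (neg_lt_zero.2 hc) 0).const_mul (d - c)
  refine Integrable.mono' hint (Measurable.aestronglyMeasurable (by fun_prop)) ?_
  refine ae_restrict_of_forall_mem measurableSet_Ioi fun t (ht : 0 < t) ↦ ?_
  rw [Real.norm_of_nonneg]
  · exact exp_neg_sub_exp_neg_div_le ht
  · exact div_nonneg (sub_nonneg.2 (Real.exp_le_exp.2
      (neg_le_neg (mul_le_mul_of_nonneg_right hcd ht.le)))) ht.le

lemma integrableOn_exp_neg_sub_exp_neg_div {c d : ℝ} (hc : 0 < c) (hd : 0 < d) :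
    IntegrableOn (fun t ↦ (Real.exp (-(c * t)) - Real.exp (-(d * t))) / t) (Ioi 0) := by
  rcases le_total c d with h | h
  · exact integrableOn_exp_neg_sub_exp_neg_div_of_le hc h
  · refine (integrableOn_exp_neg_sub_exp_neg_div_of_le hd h).neg.congr_fun (fun t _ ↦ ?_)
      measurableSet_Ioi
    simp only [Pi.neg_apply]
    ring

/-- Frullani's integral for the exponential function. -/
lemma integral_exp_neg_sub_exp_neg_div {r : ℝ} (hr : 0 < r) :
    ∫ t in Ioi (0 : ℝ), (Real.exp (-t) - Real.exp (-(t * r))) / t = Real.log r := by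
  have hcont : Continuous fun t : ℝ ↦ Real.exp (-t) := by fun_prop
  have hint := integrableOn_exp_neg_sub_exp_neg_div one_pos hr
  have h := Frullani.integral_Ioi_eq (f := fun t : ℝ ↦ Real.exp (-t)) (a := 1) (b := r)
    (hcont.locallyIntegrable.locallyIntegrableOn _) one_pos hr
    (by simpa using (hcont.tendsto 0).mono_left nhdsWithin_le_nhds)
    (Real.tendsto_exp_neg_atTop_nhds_zero)
    (by simpa [div_eq_inv_mul] using hint)
  simpa [div_eq_inv_mul, mul_comm r] using h

lemma integral_norm_exp_neg_sub_exp_neg_div {r : ℝ} (hr : 0 < r) :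
    ∫ t in Ioi (0 : ℝ), ‖(Real.exp (-t) - Real.exp (-(t * r))) / t‖ = |Real.log r| := by
  rw [← integral_exp_neg_sub_exp_neg_div hr]
  rcases le_total 1 r with h | h
  · have hnn (t : ℝ) (ht : t ∈ Ioi (0 : ℝ)) :
        0 ≤ (Real.exp (-t) - Real.exp (-(t * r))) / t :=
      div_nonneg (sub_nonneg.2 (Real.exp_le_exp.2
        (neg_le_neg (le_mul_of_one_le_right (le_of_lt ht) h)))) (le_of_lt ht)
    rw [abs_of_nonneg (setIntegral_nonneg measurableSet_Ioi hnn)]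
    exact setIntegral_congr_fun measurableSet_Ioi fun t ht ↦ Real.norm_of_nonneg (hnn t ht)
  · have hnp (t : ℝ) (ht : t ∈ Ioi (0 : ℝ)) :
        (Real.exp (-t) - Real.exp (-(t * r))) / t ≤ 0 :=
      div_nonpos_of_nonpos_of_nonneg (sub_nonpos.2 (Real.exp_le_exp.2
        (neg_le_neg (mul_le_of_le_one_right (le_of_lt ht) h)))) (le_of_lt ht)
    rw [abs_of_nonpos (setIntegral_nonpos measurableSet_Ioi hnp), ← integral_neg]
    exact setIntegral_congr_fun measurableSet_Ioi fun t ht ↦ Real.norm_of_nonpos (hnp t ht)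

/-- The expected logarithm of a positive random variable in terms of its Laplace transform. -/
lemma integral_log_eq_integral_laplace {Ω : Type*} [MeasurableSpace Ω] {μ : Measure Ω}
    [IsProbabilityMeasure μ] {X : Ω → ℝ} (hX : Measurable X) (hpos : ∀ᵐ ω ∂μ, 0 < X ω)
    (hlog : Integrable (fun ω ↦ Real.log (X ω)) μ) :
    ∫ ω, Real.log (X ω) ∂μ =
      ∫ t in Ioi (0 : ℝ), (Real.exp (-t) - ∫ ω, Real.exp (-(t * X ω)) ∂μ) / t := by
  have hF : Integrable (Function.uncurry fun ω t ↦
      (Real.exp (-t) - Real.exp (-(t * X ω))) / t) (μ.prod (volume.restrict (Ioi 0))) := by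
    refine (integrable_prod_iff ?_).2 ⟨?_, ?_⟩
    · exact Measurable.aestronglyMeasurable (by unfold Function.uncurry; fun_prop)
    · filter_upwards [hpos] with ω hω
      simpa [mul_comm (X ω), IntegrableOn] using integrableOn_exp_neg_sub_exp_neg_div one_pos hω
    · refine hlog.abs.congr ?_
      filter_upwards [hpos] with ω hω using (integral_norm_exp_neg_sub_exp_neg_div hω).symm
  calc
    ∫ ω, Real.log (X ω) ∂μ =
        ∫ ω, (∫ t in Ioi (0 : ℝ), (Real.exp (-t) - Real.exp (-(t * X ω))) / t) ∂μ := by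
      refine integral_congr_ae ?_
      filter_upwards [hpos] with ω hω using (integral_exp_neg_sub_exp_neg_div hω).symm
    _ = ∫ t in Ioi (0 : ℝ), ∫ ω, (Real.exp (-t) - Real.exp (-(t * X ω))) / t ∂μ :=
      integral_integral_swap hF
    _ = _ := by
      refine setIntegral_congr_fun measurableSet_Ioi fun t (ht : 0 < t) ↦ ?_
      have hint : Integrable (fun ω ↦ Real.exp (-(t * X ω))) μ := by
        refine (integrable_const (1 : ℝ)).mono' (by fun_prop) ?_
        filter_upwards [hpos] with ω hω
        rw [Real.norm_of_nonneg (Real.exp_pos _).le, Real.exp_le_one_iff]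
        exact neg_nonpos.2 (mul_pos ht hω).le
      rw [integral_div, integral_sub (integrable_const _) hint]
      simp

lemma ae_forall_mem_Ioo_pi_betaMeasure {ι : Type*} [Fintype ι] {b : ℝ} (hb : 0 < b)
    {a : ι → ℝ} (ha : ∀ l, 0 < a l) :
    ∀ᵐ x ∂Measure.pi (fun l ↦ betaMeasure b (a l)), ∀ l, x l ∈ Ioo (0 : ℝ) 1 := by
  have (l : ι) := isProbabilityMeasureBeta hb (ha l)
  exact ae_all_iff.2 fun l ↦
    (measurePreserving_eval _ l).quasiMeasurePreserving.ae (ae_mem_Ioo_betaMeasure b (a l))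

/-- The logarithm of a sum of independent beta variables is integrable. -/
lemma integrable_log_sum_pi_betaMeasure {ι : Type*} [Fintype ι] [Nonempty ι] {b : ℝ}
    (hb : 0 < b) {a : ι → ℝ} (ha : ∀ l, 0 < a l) :
    Integrable (fun x : ι → ℝ ↦ Real.log (∑ l, x l))
      (Measure.pi fun l ↦ betaMeasure b (a l)) := by
  have (l : ι) := isProbabilityMeasureBeta hb (ha l)
  obtain ⟨k⟩ := ‹Nonempty ι›
  have hbound : Integrable (fun x : ι → ℝ ↦ x k ^ (-(b / 2)) / (b / 2) + Fintype.card ι)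
      (Measure.pi fun l ↦ betaMeasure b (a l)) :=
    .add (.div_const ((measurePreserving_eval (fun l ↦ betaMeasure b (a l))
      k).integrable_comp_of_integrable
        (integrable_rpow_betaMeasure hb (ha k) (by linarith))) _) (integrable_const _)
  refine hbound.mono' (Measurable.aestronglyMeasurable (by fun_prop)) ?_
  filter_upwards [ae_forall_mem_Ioo_pi_betaMeasure hb ha] with x hx
  have hk : x k ≤ ∑ l, x l :=
    Finset.single_le_sum (fun l _ ↦ (hx l).1.le) (Finset.mem_univ k)
  have hle : ∑ l, x l ≤ Fintype.card ι := by
    simpa using Finset.sum_le_sum fun l (_ : l ∈ Finset.univ) ↦ (hx l).2.le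
  have hS := (hx k).1.trans_le hk
  have hpow : 0 ≤ x k ^ (-(b / 2)) / (b / 2) := by
    have := (hx k).1
    positivity
  rw [Real.norm_eq_abs, abs_le]
  constructor
  · have hlogk : -Real.log (x k) ≤ x k ^ (-(b / 2)) / (b / 2) := by
      have h := Real.log_le_rpow_div (inv_pos.2 (hx k).1).le (half_pos hb)
      rwa [Real.log_inv, Real.inv_rpow (hx k).1.le, ← Real.rpow_neg (hx k).1.le] at h
    have := Real.log_le_log (hx k).1 hk
    have : (0 : ℝ) ≤ Fintype.card ι := by positivity
    linarith
  · have := Real.log_le_sub_one_of_pos hS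
    linarith

theorem statement18 (β N : ℕ) (hβ : 0 < β) (hN : 0 < N)
    (a : Fin N → ℝ) (ha : ∀ l, 0 < a l) :
    Integrable (fun y : Fin N → Fin β → ℝ => Real.log (∑ l, ∑ s, y l s ^ 2))
      (Measure.pi fun l => betaIVecMeasure β (a l)) ∧
    ∫ y : Fin N → Fin β → ℝ, Real.log (∑ l, ∑ s, y l s ^ 2)
        ∂(Measure.pi fun l => betaIVecMeasure β (a l)) =
      ∫ t in Set.Ioi (0 : ℝ),
        (Real.exp (-t) - ∏ l, hyp1F1 ((β : ℝ) / 2) ((β : ℝ) / 2 + a l) (-t)) / t := by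
  have hb : (0 : ℝ) < (β : ℝ) / 2 := by positivity
  have : Nonempty (Fin N) := ⟨⟨0, hN⟩⟩
  have (l : Fin N) := isProbabilityMeasureBeta hb (ha l)
  have hq : Measurable fun y : Fin β → ℝ ↦ ∑ s, y s ^ 2 := by fun_prop
  have (l : Fin N) :
      SigmaFinite ((betaIVecMeasure β (a l)).map fun y : Fin β → ℝ ↦ ∑ s, y s ^ 2) := by
    rw [map_sum_sq_betaIVecMeasure hβ (ha l)]
    infer_instance
  have hmp : MeasurePreserving (fun (y : Fin N → Fin β → ℝ) l ↦ ∑ s, y l s ^ 2)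
      (Measure.pi fun l ↦ betaIVecMeasure β (a l))
      (Measure.pi fun l ↦ betaMeasure ((β : ℝ) / 2) (a l)) := by
    refine ⟨by fun_prop, ?_⟩
    rw [Measure.pi_map_pi (f := fun _ (y : Fin β → ℝ) ↦ ∑ s, y s ^ 2)
      fun _ ↦ hq.aemeasurable]
    simp only [map_sum_sq_betaIVecMeasure hβ (ha _)]
  have hlog := integrable_log_sum_pi_betaMeasure hb ha
  refine ⟨hmp.integrable_comp_of_integrable hlog, ?_⟩
  have hmap := integral_map hmp.aemeasurable (hmp.map_eq ▸ hlog.aestronglyMeasurable)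
  rw [hmp.map_eq] at hmap
  rw [← hmap, integral_log_eq_integral_laplace (by fun_prop) _ hlog]
  · refine setIntegral_congr_fun measurableSet_Ioi fun t _ ↦ ?_
    simp only [Finset.mul_sum, ← Finset.sum_neg_distrib, Real.exp_sum]
    rw [integral_fintype_prod_eq_prod fun _ (x : ℝ) ↦ Real.exp (-(t * x))]
    simp only [integral_exp_neg_mul_betaMeasure hb (ha _)]
  · filter_upwards [ae_forall_mem_Ioo_pi_betaMeasure hb ha] with x hx
    exact Finset.sum_pos (fun l _ ↦ (hx l).1) Finset.univ_nonempty
end
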